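/- arXiv:2305.02850 — 3 statements merged into one kernel-verified Lean document; each statement's English description precedes it below -/
import Mathlib

section
/- Let k = 2d for an integer d ≥ 2, let n ≥ 1 be an integer, and let p : ℕ → ℕ be any function. There exists ε₀ > 0 such that for every ε ∈ (0, ε₀): the partition C of X(n,ε,d) into the 2d ε-balls has k-means cost 2nkd·ε²; this is the optimal k-means cost of X(n,ε,d) over all partitions into at most k clusters; and every partition of X(n,ε,d) into at most k clusters other than C has k-means cost at least p(4nd²) times the k-means cost of C. -/
noncomputable section

attribute [local instance] Classical.propDecidable

/-- A threshold decision tree over `ℝ^d`: every internal node is labeled by a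
coordinate index and a real threshold. -/
inductive TDT (d : ℕ) : Type
  | leaf : TDT d
  | node (r : Fin d) (θ : ℝ) (left right : TDT d) : TDT d

namespace TDT

/-- The number of leaves of a threshold decision tree. -/
def leaves {d : ℕ} : TDT d → ℕ
  | leaf => 1
  | node _ _ l r => l.leaves + r.leaves

/-- The depth of a threshold decision tree: the maximum number of internal nodes
on a root-to-leaf path. -/
def depth {d : ℕ} : TDT d → ℕ
  | leaf => 0
  | node _ _ l r => max l.depth r.depth + 1

/-- The index (numbering leaves from left to right) of the leaf a point is routed to:
at a node labeled `(r, θ)` the point goes left when its `r`-th coordinate is `< θ`,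
and right otherwise. -/
def route {d : ℕ} : TDT d → EuclideanSpace ℝ (Fin d) → ℕ
  | leaf, _ => 0
  | node r θ l rt, x => if x r < θ then l.route x else l.leaves + rt.route x

/-- The clustering of a finite multiset induced by a threshold decision tree:
the partition of `X` into the nonempty fibers of `route` (points routed to the
same leaf form one cluster). -/
def clustering {d : ℕ} (t : TDT d) (X : Multiset (EuclideanSpace ℝ (Fin d))) :
    Multiset (Multiset (EuclideanSpace ℝ (Fin d))) :=
  Multiset.filter (fun C => C ≠ 0)
    ((Finset.range t.leaves).val.map fun i => X.filter fun x => t.route x = i)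

end TDT

/-- `P` is a partition of the multiset `X` into at most `k` nonempty clusters. -/
def IsClustering {d : ℕ} (X : Multiset (EuclideanSpace ℝ (Fin d))) (k : ℕ)
    (P : Multiset (Multiset (EuclideanSpace ℝ (Fin d)))) : Prop :=
  P.sum = X ∧ Multiset.card P ≤ k ∧ (0 : Multiset (EuclideanSpace ℝ (Fin d))) ∉ P

/-- The `1`-means cost of a single cluster: `inf_c Σ_{x ∈ C} ‖x - c‖²`. -/
def costMeans1 {d : ℕ} (C : Multiset (EuclideanSpace ℝ (Fin d))) : ℝ :=
  ⨅ c : EuclideanSpace ℝ (Fin d), (C.map fun x => ‖x - c‖ ^ 2).sum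

/-- The k-means cost of a partition. -/
def costMeans {d : ℕ} (P : Multiset (Multiset (EuclideanSpace ℝ (Fin d)))) : ℝ :=
  (P.map costMeans1).sum

/-- The `1`-median cost of a single cluster: `inf_c Σ_{x ∈ C} ‖x - c‖`. -/
def costMedian1 {d : ℕ} (C : Multiset (EuclideanSpace ℝ (Fin d))) : ℝ :=
  ⨅ c : EuclideanSpace ℝ (Fin d), (C.map fun x => ‖x - c‖).sum

/-- The k-median cost of a partition. -/
def costMedian {d : ℕ} (P : Multiset (Multiset (EuclideanSpace ℝ (Fin d)))) : ℝ :=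
  (P.map costMedian1).sum

/-- The `1`-center cost of a single cluster: `inf_c max_{x ∈ C} ‖x - c‖`. -/
def costCenter1 {d : ℕ} (C : Multiset (EuclideanSpace ℝ (Fin d))) : ℝ :=
  ⨅ c : EuclideanSpace ℝ (Fin d), sSup ((fun x => ‖x - c‖) '' {x | x ∈ C})

/-- The k-center cost of a partition: the maximum over clusters of the `1`-center cost. -/
def costCenter {d : ℕ} (P : Multiset (Multiset (EuclideanSpace ℝ (Fin d)))) : ℝ :=
  sSup (costCenter1 '' {C | C ∈ P})

/-- The optimal k-means cost of `X` over all partitions into at most `k` clusters. -/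
def optMeans {d : ℕ} (X : Multiset (EuclideanSpace ℝ (Fin d))) (k : ℕ) : ℝ :=
  sInf {r : ℝ | ∃ P, IsClustering X k P ∧ r = costMeans P}

/-- The optimal k-median cost of `X` over all partitions into at most `k` clusters. -/
def optMedian {d : ℕ} (X : Multiset (EuclideanSpace ℝ (Fin d))) (k : ℕ) : ℝ :=
  sInf {r : ℝ | ∃ P, IsClustering X k P ∧ r = costMedian P}

/-- The optimal k-center cost of `X` over all partitions into at most `k` clusters. -/
def optCenter {d : ℕ} (X : Multiset (EuclideanSpace ℝ (Fin d))) (k : ℕ) : ℝ :=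
  sInf {r : ℝ | ∃ P, IsClustering X k P ∧ r = costCenter P}

/-! ### The high-dimensional point-set `X(n, ε, d)` -/

/-- The sign `1` or `-1` encoded by a boolean. -/
def sgn (b : Bool) : ℝ := if b then 1 else -1

/-- The point `a·e_i + ε·b·e_j` (with signs `a, b` encoded by booleans). -/
def hdPoint (d : ℕ) (ε : ℝ) (i j : Fin d) (a b : Bool) : EuclideanSpace ℝ (Fin d) :=
  EuclideanSpace.single i (sgn a) + EuclideanSpace.single j (ε * sgn b)

/-- The ε-ball `B_i^a`: `n` copies of `a·e_i + ε·b·e_j` for all `j` and signs `b`. -/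
def epsBall (n d : ℕ) (ε : ℝ) (i : Fin d) (a : Bool) : Multiset (EuclideanSpace ℝ (Fin d)) :=
  (Finset.univ : Finset (Fin d × Bool)).val.bind fun jb =>
    Multiset.replicate n (hdPoint d ε i jb.1 a jb.2)

/-- The partition `C` of `X(n, ε, d)` into the `2d` ε-balls `B_i^a`. -/
def XhdPartition (n d : ℕ) (ε : ℝ) : Multiset (Multiset (EuclideanSpace ℝ (Fin d))) :=
  (Finset.univ : Finset (Fin d × Bool)).val.map fun ia => epsBall n d ε ia.1 ia.2

/-- The multiset `X(n, ε, d)`: `n` copies of `a·e_i + ε·b·e_j` for all `i, j ∈ [d]`,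
`a, b ∈ {1, -1}`; it has `4nd²` points counted with multiplicity. -/
def Xhd (n d : ℕ) (ε : ℝ) : Multiset (EuclideanSpace ℝ (Fin d)) :=
  (XhdPartition n d ε).sum

/-! ### The weighted planar point-set `X(w, h)` -/

/-- A pair of reals viewed as a point of the Euclidean plane. -/
def toE2 (q : ℝ × ℝ) : EuclideanSpace ℝ (Fin 2) :=
  (WithLp.equiv 2 (Fin 2 → ℝ)).symm ![q.1, q.2]

/-- `planarP h i = (p_i^1, p_i^2)`, the two points of the `i`-th cluster of the
weighted planar point-set `X(w, h)` (positions depend only on `h`). -/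
def planarP (h : ℕ → ℝ) : ℕ → (ℝ × ℝ) × (ℝ × ℝ)
  | 0 => ((0, 0), (0, 0))
  | 1 => ((0, 0), (0, 0))
  | 2 => ((h 2, 0), (h 2, 0))
  | i + 3 =>
      let q := planarP h (i + 1)
      let q' := planarP h (i + 2)
      if (i + 3) % 2 = 1 then
        ((q.1.1 - 1, q.1.2 + h (i + 3)), (q'.2.1 + 1, q.2.2 + h (i + 3)))
      else
        ((q.1.1 + h (i + 3), q.1.2 - 1), (q.2.1 + h (i + 3), q'.2.2 + 1))

/-- The position of the weighted point indexed by `(i, a) : Fin k × Fin 2`,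
i.e. `p_{i+1}^{a+1}`. -/
def wpt (k : ℕ) (h : ℕ → ℝ) (x : Fin k × Fin 2) : EuclideanSpace ℝ (Fin 2) :=
  toE2 (if x.2 = (0 : Fin 2) then (planarP h ((x.1 : ℕ) + 1)).1
        else (planarP h ((x.1 : ℕ) + 1)).2)

/-- `P` is a partition of the index set of the `2k` weighted points into at most `k`
nonempty clusters. -/
def IsIdxPartition (k : ℕ) (P : Finset (Finset (Fin k × Fin 2))) : Prop :=
  P.card ≤ k ∧ (∀ S ∈ P, S.Nonempty) ∧
    ∀ x : Fin k × Fin 2, ∃! S : Finset (Fin k × Fin 2), S ∈ P ∧ x ∈ S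

/-- The weighted k-means cost of a partition of the index set of `X(w, h)`. -/
def wCostMeans (k : ℕ) (h w : ℕ → ℝ) (P : Finset (Finset (Fin k × Fin 2))) : ℝ :=
  ∑ S ∈ P, ⨅ c : EuclideanSpace ℝ (Fin 2),
    ∑ x ∈ S, w ((x.1 : ℕ) + 1) * ‖wpt k h x - c‖ ^ 2

/-- The weighted k-median cost of a partition of the index set of `X(w, h)`. -/
def wCostMedian (k : ℕ) (h w : ℕ → ℝ) (P : Finset (Finset (Fin k × Fin 2))) : ℝ :=
  ∑ S ∈ P, ⨅ c : EuclideanSpace ℝ (Fin 2),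
    ∑ x ∈ S, w ((x.1 : ℕ) + 1) * ‖wpt k h x - c‖

/-- The minimum weighted k-means cost over all partitions of the `2k` weighted points
into at most `k` clusters. -/
def wOptMeans (k : ℕ) (h w : ℕ → ℝ) : ℝ :=
  sInf {r : ℝ | ∃ P, IsIdxPartition k P ∧ r = wCostMeans k h w P}

/-- The minimum weighted k-median cost over all partitions of the `2k` weighted points
into at most `k` clusters. -/
def wOptMedian (k : ℕ) (h w : ℕ → ℝ) : ℝ :=
  sInf {r : ℝ | ∃ P, IsIdxPartition k P ∧ r = wCostMedian k h w P}

/-- The canonical partition `C = (C_1, …, C_k)` of the index set, where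
`C_i = {p_i^1, p_i^2}`. -/
def wCanonical (k : ℕ) : Finset (Finset (Fin k × Fin 2)) :=
  (Finset.univ : Finset (Fin k)).image fun i =>
    Finset.univ.filter fun x : Fin k × Fin 2 => x.1 = i

/-- The partition of the index set of the `2k` weighted points induced by a threshold
decision tree (nonempty fibers of the routing of the corresponding positions). -/
def treeIdxPartition (k : ℕ) (t : TDT 2) (h : ℕ → ℝ) : Finset (Finset (Fin k × Fin 2)) :=
  Finset.filter (fun S => S.Nonempty)
    ((Finset.range t.leaves).image fun ℓ =>
      Finset.univ.filter fun x : Fin k × Fin 2 => t.route (wpt k h x) = ℓ)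

/-! ### The planar point-set `Y_k` for k-center -/

/-- The four points of the first cluster of `Y_k`. -/
def Ybase1 : Fin 4 → ℝ × ℝ := ![(-1, 0), (-1.5, 0.5), (-1, 1), (-0.5, 0.5)]

/-- The four points of the second cluster of `Y_k`. -/
def Ybase2 : Fin 4 → ℝ × ℝ := ![(1, 0), (0.5, 0.5), (1, 1), (1.5, 0.5)]

/-- `Ypt i a = p_i^{a+1}`, the `a`-th point of the `i`-th cluster of `Y_k`. -/
def Ypt : ℕ → Fin 4 → ℝ × ℝ
  | 0, _ => (0, 0)
  | 1, a => Ybase1 a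
  | 2, a => Ybase2 a
  | 3, a => Ybase1 a + (1, 2)
  | 4, a => Ybase2 a + (2, 1)
  | i + 5, a => Ypt (i + 3) a + (2, 2)

/-- The cluster `C_i = {p_i^1, p_i^2, p_i^3, p_i^4}` of `Y_k`. -/
def Ycluster (i : ℕ) : Multiset (EuclideanSpace ℝ (Fin 2)) :=
  (Finset.univ : Finset (Fin 4)).val.map fun a => toE2 (Ypt i a)

/-- The partition `C = (C_1, …, C_k)` of `Y_k`. -/
def Ypartition (k : ℕ) : Multiset (Multiset (EuclideanSpace ℝ (Fin 2))) :=
  (Finset.range k).val.map fun i => Ycluster (i + 1)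

/-- The point-set `Y_k` (as a multiset of `4k` points in the plane). -/
def Yset (k : ℕ) : Multiset (EuclideanSpace ℝ (Fin 2)) := (Ypartition k).sum


/-- A partition of `∑ i, B i` into at most as many clusters as there are indices, each
carrying a single label, is the partition into the `B i`. -/
theorem eq_map_of_constant_label {α ι : Type*} [Fintype ι] (B : ι → Multiset α) (f : α → ι)
    (hf : ∀ i, ∀ x ∈ B i, f x = i) (hB : ∀ i, B i ≠ 0) (P : Multiset (Multiset α))
    (hsum : P.sum = ((Finset.univ : Finset ι).val.map B).sum)
    (hcard : Multiset.card P ≤ Fintype.card ι)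
    (hconst : ∀ C ∈ P, ∀ x ∈ C, ∀ y ∈ C, f x = f y) :
    P = (Finset.univ : Finset ι).val.map B := by
  have hmem : ∀ x, (∃ C ∈ P, x ∈ C) ↔ ∃ i, x ∈ B i := by
    intro x
    have h1 : x ∈ P.sum ↔ x ∈ ((Finset.univ : Finset ι).val.map B).sum := by rw [hsum]
    have hj : ∀ S : Multiset (Multiset α), x ∈ S.sum ↔ ∃ C ∈ S, x ∈ C := fun S =>
      Multiset.mem_join
    rw [hj, hj] at h1
    simpa using h1
  have hfilter : ∀ i, P.sum.filter (fun x => f x = i) = B i := by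
    intro i
    have hs : ((Finset.univ : Finset ι).val.map B).sum = ∑ j, B j := rfl
    let φ : Multiset α →+ Multiset α :=
      { toFun := Multiset.filter fun x => f x = i
        map_zero' := rfl
        map_add' := Multiset.filter_add _ }
    have hφ : (∑ j, B j).filter (fun x => f x = i) = ∑ j, (B j).filter fun x => f x = i :=
      map_sum φ B _
    rw [hsum, hs, hφ, Finset.sum_eq_single i]
    · exact Multiset.filter_eq_self.2 (hf i)
    · intro j _ hji
      exact Multiset.filter_eq_nil.2 fun x hx h => hji ((hf j x hx).symm.trans h)
    · simp
  rcases isEmpty_or_nonempty ι with hι | ⟨⟨i₀⟩⟩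
  · rw [Fintype.card_eq_zero] at hcard
    simp [Multiset.card_eq_zero.1 (Nat.le_zero.1 hcard)]
  have hg : ∃ g : Multiset α → ι, ∀ C ∈ P, ∀ x ∈ C, f x = g C := by
    refine ⟨fun C => if h : ∃ x, x ∈ C then f h.choose else i₀, fun C hC x hx => ?_⟩
    have h : ∃ x, x ∈ C := ⟨x, hx⟩
    simp only [h, dif_pos]
    exact hconst C hC x hx _ h.choose_spec
  obtain ⟨g, hg⟩ := hg
  have hle : (Finset.univ : Finset ι).val ≤ P.map g := by
    refine (Multiset.le_iff_subset Finset.univ.nodup).2 fun i _ => ?_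
    obtain ⟨x, hx⟩ := Multiset.exists_mem_of_ne_zero (hB i)
    obtain ⟨C, hC, hxC⟩ := (hmem x).2 ⟨i, hx⟩
    exact Multiset.mem_map.2 ⟨C, hC, (hg C hC x hxC).symm.trans (hf i x hx)⟩
  have heq : (Finset.univ : Finset ι).val = P.map g :=
    Multiset.eq_of_le_of_card_le hle (by simpa using hcard)
  have hnodup : (P.map g).Nodup := heq ▸ Finset.univ.nodup
  have hBg : ∀ C ∈ P, B (g C) = C := by
    intro C hC
    obtain ⟨Q, rfl⟩ := Multiset.exists_cons_of_mem hC
    rw [Multiset.map_cons, Multiset.nodup_cons] at hnodup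
    rw [← hfilter, Multiset.sum_cons, Multiset.filter_add,
      Multiset.filter_eq_self.2 (hg C hC), Multiset.filter_eq_nil.2, add_zero]
    intro x hx h
    obtain ⟨D, hD, hxD⟩ := Multiset.mem_join.1 hx
    exact hnodup.1 (Multiset.mem_map.2
      ⟨D, hD, (hg D (Multiset.mem_cons_of_mem hD) x hxD).symm.trans h⟩)
  rw [heq, Multiset.map_map]
  conv_lhs => rw [← Multiset.map_id P]
  exact Multiset.map_congr rfl fun C hC => (hBg C hC).symm

theorem costMeans1_nonneg {d : ℕ} (C : Multiset (EuclideanSpace ℝ (Fin d))) :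
    0 ≤ costMeans1 C :=
  Real.iInf_nonneg fun _ => Multiset.sum_nonneg fun r hr => by
    obtain ⟨x, -, rfl⟩ := Multiset.mem_map.1 hr
    positivity

theorem costMeans1_le_costMeans {d : ℕ} {P : Multiset (Multiset (EuclideanSpace ℝ (Fin d)))}
    {C : Multiset (EuclideanSpace ℝ (Fin d))} (hC : C ∈ P) : costMeans1 C ≤ costMeans P :=
  Multiset.single_le_sum (fun r hr => by
    obtain ⟨D, -, rfl⟩ := Multiset.mem_map.1 hr
    exact costMeans1_nonneg D) _ (Multiset.mem_map_of_mem _ hC)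

/-- A cluster containing two distinct points has cost at least half their squared distance. -/
theorem half_sq_norm_sub_le_costMeans1 {d : ℕ} {C : Multiset (EuclideanSpace ℝ (Fin d))}
    {x y : EuclideanSpace ℝ (Fin d)} (hx : x ∈ C) (hy : y ∈ C) (hxy : x ≠ y) :
    ‖x - y‖ ^ 2 / 2 ≤ costMeans1 C := by
  refine le_ciInf fun c => ?_
  obtain ⟨Q, rfl⟩ := Multiset.exists_cons_of_mem hx
  obtain ⟨R, rfl⟩ := Multiset.exists_cons_of_mem
    ((Multiset.mem_cons.1 hy).resolve_left (Ne.symm hxy))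
  simp only [Multiset.map_cons, Multiset.sum_cons]
  have hR : 0 ≤ (R.map fun z => ‖z - c‖ ^ 2).sum := Multiset.sum_nonneg fun r hr => by
    obtain ⟨z, -, rfl⟩ := Multiset.mem_map.1 hr
    positivity
  have htri : ‖x - y‖ ≤ ‖x - c‖ + ‖y - c‖ := by
    simpa [norm_sub_rev y c] using norm_sub_le_norm_sub_add_norm_sub x c y
  nlinarith [sq_nonneg (‖x - c‖ - ‖y - c‖), norm_nonneg (x - y), norm_nonneg (x - c),
    norm_nonneg (y - c)]

theorem abs_sgn (b : Bool) : |sgn b| = 1 := by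
  cases b <;> simp [sgn]

theorem mem_epsBall_iff {n d : ℕ} {ε : ℝ} {i : Fin d} {a : Bool} {x : EuclideanSpace ℝ (Fin d)} :
    x ∈ epsBall n d ε i a ↔ n ≠ 0 ∧ ∃ j b, x = hdPoint d ε i j a b := by
  simp [epsBall, Multiset.mem_bind, Multiset.mem_replicate]

theorem epsBall_ne_zero {n d : ℕ} (hn : n ≠ 0) (ε : ℝ) (i : Fin d) (a : Bool) :
    epsBall n d ε i a ≠ 0 := fun h =>
  Multiset.notMem_zero (hdPoint d ε i i a true)
    (h ▸ mem_epsBall_iff.2 ⟨hn, i, true, rfl⟩)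

theorem one_le_norm_single_sgn_sub {d : ℕ} {p q : Fin d × Bool} (hpq : p ≠ q) :
    1 ≤ ‖EuclideanSpace.single p.1 (sgn p.2) - EuclideanSpace.single q.1 (sgn q.2)‖ := by
  refine le_trans ?_ (PiLp.norm_apply_le _ p.1)
  obtain ⟨i, a⟩ := p
  obtain ⟨j, b⟩ := q
  by_cases hij : i = j
  · subst hij
    have hab : a ≠ b := fun h => hpq (by rw [h])
    cases a <;> cases b <;> first | exact absurd rfl hab | norm_num [sgn]
  · simp [hij, abs_sgn]

theorem half_le_norm_sub_of_mem_epsBall {n d : ℕ} {ε : ℝ} (h0 : 0 < ε) (hε : ε ≤ 1 / 4)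
    {p q : Fin d × Bool} (hpq : p ≠ q) {x y : EuclideanSpace ℝ (Fin d)}
    (hx : x ∈ epsBall n d ε p.1 p.2) (hy : y ∈ epsBall n d ε q.1 q.2) : 1 / 2 ≤ ‖x - y‖ := by
  obtain ⟨-, j, b, rfl⟩ := mem_epsBall_iff.1 hx
  obtain ⟨-, l, c, rfl⟩ := mem_epsBall_iff.1 hy
  have hn : ∀ (j : Fin d) (b : Bool), ‖EuclideanSpace.single j (ε * sgn b)‖ = ε := fun j b => by
    simp [abs_sgn, abs_of_pos h0]
  have h1 := one_le_norm_single_sgn_sub hpq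
  have h2 : EuclideanSpace.single p.1 (sgn p.2) - EuclideanSpace.single q.1 (sgn q.2) =
      (hdPoint d ε p.1 j p.2 b - hdPoint d ε q.1 l q.2 c)
        + (EuclideanSpace.single l (ε * sgn c) - EuclideanSpace.single j (ε * sgn b)) := by
    simp only [hdPoint]; abel
  rw [h2] at h1
  have h3 := norm_add_le (hdPoint d ε p.1 j p.2 b - hdPoint d ε q.1 l q.2 c)
    (EuclideanSpace.single l (ε * sgn c) - EuclideanSpace.single j (ε * sgn b))
  have h4 := norm_sub_le (EuclideanSpace.single l (ε * sgn c))
    (EuclideanSpace.single j (ε * sgn b))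
  rw [hn, hn] at h4
  linarith

theorem sum_sq_norm_sub_epsBall (n d : ℕ) (ε : ℝ) (i : Fin d) (a : Bool)
    (c : EuclideanSpace ℝ (Fin d)) :
    ((epsBall n d ε i a).map fun x => ‖x - c‖ ^ 2).sum =
      2 * n * d * ‖EuclideanSpace.single i (sgn a) - c‖ ^ 2 + 2 * n * d * ε ^ 2 := by
  have hj : ∀ j : Fin d, ∑ b : Bool, ‖hdPoint d ε i j a b - c‖ ^ 2 =
      2 * ‖EuclideanSpace.single i (sgn a) - c‖ ^ 2 + 2 * ε ^ 2 := by
    intro j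
    have hp := parallelogram_law_with_norm ℝ (EuclideanSpace.single i (sgn a) - c)
      (EuclideanSpace.single j ε)
    have ht : hdPoint d ε i j a true - c =
        (EuclideanSpace.single i (sgn a) - c) + EuclideanSpace.single j ε := by
      simp only [hdPoint, sgn, if_true, mul_one]; abel
    have hf : hdPoint d ε i j a false - c =
        (EuclideanSpace.single i (sgn a) - c) - EuclideanSpace.single j ε := by
      have : EuclideanSpace.single j (ε * sgn false) = -EuclideanSpace.single j ε := by
        ext l
        by_cases h : l = j <;> simp [sgn, h]
      rw [hdPoint, this]; abel
    have hs : ‖EuclideanSpace.single j ε‖ * ‖EuclideanSpace.single j ε‖ = ε ^ 2 := by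
      rw [PiLp.norm_single, Real.norm_eq_abs, abs_mul_abs_self, sq]
    rw [Fintype.sum_bool, ht, hf]
    linarith
  have hsum : ((epsBall n d ε i a).map fun x => ‖x - c‖ ^ 2).sum =
      ∑ jb : Fin d × Bool, n * ‖hdPoint d ε i jb.1 a jb.2 - c‖ ^ 2 := by
    rw [epsBall, Multiset.map_bind, Multiset.sum_bind]
    simp only [Multiset.map_replicate, Multiset.sum_replicate, nsmul_eq_mul]
    rfl
  rw [hsum, Fintype.sum_prod_type]
  simp only [← Finset.mul_sum, hj]
  simp
  ring

theorem costMeans1_epsBall (n d : ℕ) (ε : ℝ) (i : Fin d) (a : Bool) :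
    costMeans1 (epsBall n d ε i a) = 2 * n * d * ε ^ 2 := by
  simp only [costMeans1, sum_sq_norm_sub_epsBall]
  refine le_antisymm ?_ (le_ciInf fun c => le_add_of_nonneg_left (by positivity))
  refine (ciInf_le ⟨0, ?_⟩ (EuclideanSpace.single i (sgn a))).trans_eq (by simp)
  rintro _ ⟨c, rfl⟩
  positivity

theorem costMeans_XhdPartition (n d : ℕ) (ε : ℝ) :
    costMeans (XhdPartition n d ε) = ((2 * n * (2 * d) * d : ℕ) : ℝ) * ε ^ 2 := by
  simp only [costMeans, XhdPartition, Multiset.map_map, Function.comp_def, costMeans1_epsBall]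
  simp
  ring

theorem isClustering_XhdPartition {n : ℕ} (hn : n ≠ 0) (d : ℕ) (ε : ℝ) :
    IsClustering (Xhd n d ε) (2 * d) (XhdPartition n d ε) := by
  refine ⟨rfl, ?_, fun h => ?_⟩
  · simp [XhdPartition, mul_comm]
  · obtain ⟨ia, -, h⟩ := Multiset.mem_map.1 h
    exact epsBall_ne_zero hn ε ia.1 ia.2 h

/-- A clustering of `X(n, ε, d)` other than the one into `ε`-balls has cost at least `1 / 8`. -/
theorem one_eighth_le_costMeans {n d : ℕ} (hn : n ≠ 0) (hd : d ≠ 0) {ε : ℝ} (h0 : 0 < ε)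
    (hε : ε ≤ 1 / 4) {P : Multiset (Multiset (EuclideanSpace ℝ (Fin d)))}
    (hP : IsClustering (Xhd n d ε) (2 * d) P) (hne : P ≠ XhdPartition n d ε) :
    1 / 8 ≤ costMeans P := by
  obtain ⟨hsum, hcard, -⟩ := hP
  let B : Fin d × Bool → Multiset (EuclideanSpace ℝ (Fin d)) := fun ia => epsBall n d ε ia.1 ia.2
  have hdist : ∀ {p q : Fin d × Bool} {x y}, p ≠ q → x ∈ B p → y ∈ B q → 1 / 2 ≤ ‖x - y‖ :=
    fun hpq hx hy => half_le_norm_sub_of_mem_epsBall h0 hε hpq hx hy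
  have hf : ∃ f : EuclideanSpace ℝ (Fin d) → Fin d × Bool, ∀ i, ∀ x ∈ B i, f x = i := by
    refine ⟨fun x => if h : ∃ i, x ∈ B i then h.choose else (⟨0, Nat.pos_of_ne_zero hd⟩, true),
      fun i x hx => ?_⟩
    have h : ∃ i, x ∈ B i := ⟨i, hx⟩
    simp only [h, dif_pos]
    by_contra hi
    have := hdist hi h.choose_spec hx
    norm_num at this
  obtain ⟨f, hf⟩ := hf
  have hmixed : ∃ C ∈ P, ∃ x ∈ C, ∃ y ∈ C, f x ≠ f y := by
    by_contra! hcon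
    exact hne (eq_map_of_constant_label B f hf (fun i => epsBall_ne_zero hn ε i.1 i.2) P hsum
      (by simpa [mul_comm] using hcard) hcon)
  obtain ⟨C, hC, x, hx, y, hy, hxy⟩ := hmixed
  have hlabel : ∀ z ∈ C, z ∈ B (f z) := by
    intro z hz
    have hzX : z ∈ (XhdPartition n d ε).sum := by
      have : z ∈ P.sum := Multiset.mem_join.2 ⟨C, hC, hz⟩
      rwa [hsum] at this
    obtain ⟨D, hD, hzD⟩ := Multiset.mem_join.1 hzX
    obtain ⟨i, -, rfl⟩ := Multiset.mem_map.1 hD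
    rwa [hf i z hzD]
  have h1 := hdist hxy (hlabel x hx) (hlabel y hy)
  have h2 := half_sq_norm_sub_le_costMeans1 hx hy fun h => hxy (h ▸ rfl)
  have h3 := costMeans1_le_costMeans hC
  nlinarith

/-- STATEMENT: optimality of the ε-ball partition of `X(n, ε, d)` and the cost of any
other partition, for the k-means objective (`k = 2d`). -/
theorem stmt_3 (d n : ℕ) (hd : 2 ≤ d) (hn : 1 ≤ n) (p : ℕ → ℕ) :
    ∃ ε₀ : ℝ, 0 < ε₀ ∧ ∀ ε : ℝ, 0 < ε → ε < ε₀ →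
      costMeans (XhdPartition n d ε) = ((2 * n * (2 * d) * d : ℕ) : ℝ) * ε ^ 2 ∧
      optMeans (Xhd n d ε) (2 * d) = costMeans (XhdPartition n d ε) ∧
      ∀ P, IsClustering (Xhd n d ε) (2 * d) P → P ≠ XhdPartition n d ε →
        (p (4 * n * d ^ 2) : ℝ) * costMeans (XhdPartition n d ε) ≤ costMeans P := by
  have hn0 : n ≠ 0 := Nat.one_le_iff_ne_zero.1 hn
  have hd0 : d ≠ 0 := by omega
  set N : ℝ := ((2 * n * (2 * d) * d : ℕ) : ℝ) with hN
  set M : ℝ := p (4 * n * d ^ 2) + 1 with hM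
  have hN0 : 0 ≤ N := Nat.cast_nonneg _
  have hp0 : (0 : ℝ) ≤ p (4 * n * d ^ 2) := Nat.cast_nonneg _
  have hMN : 0 ≤ M * N := by positivity
  refine ⟨1 / (8 * (M * N + 1)), by positivity, fun ε h0 hε => ?_⟩
  have hε' : ε * (8 * (M * N + 1)) < 1 := (lt_div_iff₀ (by positivity)).1 hε
  have hε4 : ε ≤ 1 / 4 := by nlinarith
  have hcost := costMeans_XhdPartition n d ε
  have hsmall : M * costMeans (XhdPartition n d ε) ≤ 1 / 8 := by
    rw [hcost]
    nlinarith [mul_nonneg hMN h0.le]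
  have hC0 : 0 ≤ costMeans (XhdPartition n d ε) := by
    rw [hcost]
    positivity
  have hC := isClustering_XhdPartition hn0 d ε
  refine ⟨hcost, ?_, fun P hP hne => ?_⟩
  · refine IsLeast.csInf_eq ⟨⟨_, hC, rfl⟩, ?_⟩
    rintro _ ⟨P, hP, rfl⟩
    by_cases hne : P = XhdPartition n d ε
    · rw [hne]
    · have := one_eighth_le_costMeans hn0 hd0 h0 hε4 hP hne
      nlinarith
  · have := one_eighth_le_costMeans hn0 hd0 h0 hε4 hP hne
    nlinarith

end
end

section
/- Let k = 2d for an integer d ≥ 2, let n ≥ 1 be an integer, and let ε ∈ (0, 1/4). Then every threshold decision tree over ℝ^d with k leaves and depth at most k−2 induces a clustering of X(n,ε,d) that differs from the partition C into the 2d ε-balls; that is, at least one point of X(n,ε,d) is classified into a leaf together with a point from a different ε-ball, or some ε-ball is split between leaves. -/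
noncomputable section

attribute [local instance] Classical.propDecidable

lemma TDT.route_lt_leaves {d : ℕ} (t : TDT d) (x : EuclideanSpace ℝ (Fin d)) :
    t.route x < t.leaves := by
  induction t with
  | leaf => simp [TDT.route, TDT.leaves]
  | node r θ l rt ihl ihr =>
    simp only [TDT.route, TDT.leaves]
    split_ifs <;> omega

lemma TDT.lt_iff_of_route_node_eq {d : ℕ} {r : Fin d} {θ : ℝ} {l rt : TDT d}
    {x y : EuclideanSpace ℝ (Fin d)}
    (h : (TDT.node r θ l rt).route x = (TDT.node r θ l rt).route y) :
    x r < θ ↔ y r < θ := by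
  have hx := l.route_lt_leaves x
  have hy := l.route_lt_leaves y
  simp only [TDT.route] at h
  split_ifs at h with h1 h2 h2
  · simp [h1, h2]
  · omega
  · omega
  · simp [h1, h2]

lemma hdPoint_apply (d : ℕ) (ε : ℝ) (i j r : Fin d) (a b : Bool) :
    hdPoint d ε i j a b r =
      (if r = i then sgn a else 0) + (if r = j then ε * sgn b else 0) := by
  simp [hdPoint]

lemma hdPoint_mem_epsBall {n d : ℕ} (hn : 1 ≤ n) (ε : ℝ) (i j : Fin d) (a b : Bool) :
    hdPoint d ε i j a b ∈ epsBall n d ε i a := by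
  simp only [epsBall, Multiset.mem_bind, Multiset.mem_replicate]
  exact ⟨(j, b), by simp, by omega, rfl⟩

lemma exists_eq_hdPoint_of_mem_epsBall {n d : ℕ} {ε : ℝ} {i : Fin d} {a : Bool}
    {x : EuclideanSpace ℝ (Fin d)} (hx : x ∈ epsBall n d ε i a) :
    ∃ j b, x = hdPoint d ε i j a b := by
  simp only [epsBall, Multiset.mem_bind, Multiset.mem_replicate] at hx
  obtain ⟨jb, -, -, h⟩ := hx
  exact ⟨jb.1, jb.2, h⟩

/-- A cut that splits none of the ε-balls indexed by `S` has at most one of these balls on one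
of its two sides. -/
lemma card_filter_le_one_or {d : ℕ} {ε : ℝ} (hε : 0 < ε) (r : Fin d) (θ : ℝ)
    (S : Finset (Fin d × Bool)) (q₀ : Fin d × Bool)
    (hS : ∀ s ∈ S, ∀ q q' : Fin d × Bool,
      (hdPoint d ε s.1 q.1 s.2 q.2 r < θ ↔ hdPoint d ε s.1 q'.1 s.2 q'.2 r < θ)) :
    (S.filter fun s => hdPoint d ε s.1 q₀.1 s.2 q₀.2 r < θ).card ≤ 1 ∨
      (S.filter fun s => ¬ hdPoint d ε s.1 q₀.1 s.2 q₀.2 r < θ).card ≤ 1 := by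
  by_contra h
  rw [not_or, not_le, not_le] at h
  have h1 : ∃ s ∈ S.filter fun s => hdPoint d ε s.1 q₀.1 s.2 q₀.2 r < θ, s ≠ (r, false) :=
    Finset.exists_mem_ne h.1 _
  have h2 : ∃ s ∈ S.filter fun s => ¬ hdPoint d ε s.1 q₀.1 s.2 q₀.2 r < θ, s ≠ (r, true) :=
    Finset.exists_mem_ne h.2 _
  obtain ⟨⟨i, a⟩, hs, hne⟩ := h1
  obtain ⟨⟨i', a'⟩, hs', hne'⟩ := h2
  rw [Finset.mem_filter] at hs hs'
  have e1 := (hS _ hs.1 q₀ (r, true)).1 hs.2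
  have e2 := mt (hS _ hs'.1 q₀ (r, false)).2 hs'.2
  simp only [hdPoint_apply, if_true] at e1 e2
  have c1 : 0 ≤ if r = i then sgn a else 0 := by
    split_ifs with hr
    · subst hr; cases a <;> simp_all [sgn]
    · exact le_rfl
  have c2 : (if r = i' then sgn a' else 0) ≤ 0 := by
    split_ifs with hr
    · subst hr; cases a' <;> simp_all [sgn]
    · exact le_rfl
  simp only [sgn, if_true, Bool.false_eq_true, if_false] at e1 e2 c1 c2
  linarith

/-- A tree that keeps each of the ε-balls indexed by `S` in one leaf, and distinct balls in
distinct leaves, has depth at least `S.card - 1`. -/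
lemma card_le_depth_add_one {d : ℕ} {ε : ℝ} (hε : 0 < ε) (q₀ : Fin d × Bool) (t : TDT d)
    (S : Finset (Fin d × Bool))
    (hS : ∀ s ∈ S, ∀ q q' : Fin d × Bool,
      t.route (hdPoint d ε s.1 q.1 s.2 q.2) = t.route (hdPoint d ε s.1 q'.1 s.2 q'.2))
    (hinj : ∀ s ∈ S, ∀ s' ∈ S,
      t.route (hdPoint d ε s.1 q₀.1 s.2 q₀.2) = t.route (hdPoint d ε s'.1 q₀.1 s'.2 q₀.2) →
        s = s') :
    S.card ≤ t.depth + 1 := by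
  induction t generalizing S with
  | leaf => exact Finset.card_le_one.2 fun s hs s' hs' => hinj s hs s' hs' rfl
  | node r θ l rt ihl ihr =>
    have hcut : ∀ s ∈ S, ∀ q q' : Fin d × Bool,
        (hdPoint d ε s.1 q.1 s.2 q.2 r < θ ↔ hdPoint d ε s.1 q'.1 s.2 q'.2 r < θ) :=
      fun s hs q q' => TDT.lt_iff_of_route_node_eq (hS s hs q q')
    have hL := ihl (S.filter fun s => hdPoint d ε s.1 q₀.1 s.2 q₀.2 r < θ)
      (by
        intro s hs q q'
        rw [Finset.mem_filter] at hs
        have h := hS s hs.1 q q'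
        simpa only [TDT.route, if_pos ((hcut s hs.1 q₀ q).1 hs.2),
          if_pos ((hcut s hs.1 q₀ q').1 hs.2)] using h)
      (by
        intro s hs s' hs' h
        rw [Finset.mem_filter] at hs hs'
        apply hinj s hs.1 s' hs'.1
        simpa only [TDT.route, if_pos hs.2, if_pos hs'.2] using h)
    have hR := ihr (S.filter fun s => ¬ hdPoint d ε s.1 q₀.1 s.2 q₀.2 r < θ)
      (by
        intro s hs q q'
        rw [Finset.mem_filter] at hs
        have h := hS s hs.1 q q'
        simp only [TDT.route, if_neg (mt (hcut s hs.1 q₀ q).2 hs.2),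
          if_neg (mt (hcut s hs.1 q₀ q').2 hs.2)] at h
        omega)
      (by
        intro s hs s' hs' h
        rw [Finset.mem_filter] at hs hs'
        apply hinj s hs.1 s' hs'.1
        simp only [TDT.route, if_neg hs.2, if_neg hs'.2, h])
    have hsum := S.card_filter_add_card_filter_not
      (fun s => hdPoint d ε s.1 q₀.1 s.2 q₀.2 r < θ)
    have hone := card_filter_le_one_or hε r θ S q₀ hcut
    simp only [TDT.depth]
    omega

lemma epsBall_injective {n d : ℕ} (hn : 1 ≤ n) {ε : ℝ} (hε : 0 < ε) {i i' : Fin d}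
    {a a' : Bool} (h : epsBall n d ε i a = epsBall n d ε i' a') : (i, a) = (i', a') := by
  have hmem := hdPoint_mem_epsBall hn ε i i a a
  rw [h] at hmem
  obtain ⟨j, b, hx⟩ := exists_eq_hdPoint_of_mem_epsBall hmem
  have hi := congrArg (fun x : EuclideanSpace ℝ (Fin d) => x i) hx
  simp only [hdPoint_apply, if_true] at hi
  by_cases hii : i = i'
  · subst hii
    cases a <;> cases a' <;> cases b <;> by_cases hj : i = j <;>
      simp [sgn, hj] at hi ⊢ <;> linarith
  · cases a <;> cases b <;> by_cases hj : i = j <;>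
      simp [sgn, hj, hii] at hi <;> first | linarith | (split_ifs at hi <;> simp_all <;> linarith)

lemma route_eq_iff_of_clustering_eq {d n : ℕ} (hn : 1 ≤ n) {ε : ℝ} (hε : 0 < ε) {t : TDT d}
    (h : t.clustering (Xhd n d ε) = XhdPartition n d ε) (s s' q q' : Fin d × Bool) :
    t.route (hdPoint d ε s.1 q.1 s.2 q.2) = t.route (hdPoint d ε s'.1 q'.1 s'.2 q'.2) ↔
      s = s' := by
  have key : ∀ s : Fin d × Bool, ∃ i, epsBall n d ε s.1 s.2 =
      (Xhd n d ε).filter fun x => t.route x = i := by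
    intro s
    have hmem : epsBall n d ε s.1 s.2 ∈ XhdPartition n d ε :=
      Multiset.mem_map_of_mem _ (Finset.mem_univ s)
    rw [← h, TDT.clustering, Multiset.mem_filter, Multiset.mem_map] at hmem
    obtain ⟨⟨i, -, hi⟩, -⟩ := hmem
    exact ⟨i, hi.symm⟩
  have hroute : ∀ {s : Fin d × Bool} {i : ℕ}, epsBall n d ε s.1 s.2 =
      ((Xhd n d ε).filter fun x => t.route x = i) → ∀ q : Fin d × Bool,
      t.route (hdPoint d ε s.1 q.1 s.2 q.2) = i := by
    intro s i hi q
    have hmem := hdPoint_mem_epsBall hn ε s.1 q.1 s.2 q.2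
    rw [hi, Multiset.mem_filter] at hmem
    exact hmem.2
  obtain ⟨i, hi⟩ := key s
  obtain ⟨i', hi'⟩ := key s'
  constructor
  · intro heq
    rw [hroute hi, hroute hi'] at heq
    subst heq
    exact epsBall_injective hn hε (hi.trans hi'.symm)
  · rintro rfl
    rw [hroute hi, hroute hi]

/-- STATEMENT: every threshold decision tree with `2d` leaves and depth at most `2d - 2`
induces on `X(n, ε, d)` a clustering different from the partition into the `2d` ε-balls. -/
theorem stmt_7 (d n : ℕ) (hd : 2 ≤ d) (hn : 1 ≤ n) (ε : ℝ) (hε : 0 < ε)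
    (hε' : ε < 1 / 4) :
    ∀ t : TDT d, t.leaves = 2 * d → t.depth ≤ 2 * d - 2 →
      t.clustering (Xhd n d ε) ≠ XhdPartition n d ε := by
  intro t _ hdepth h
  have hroute := route_eq_iff_of_clustering_eq hn hε h
  have hcard := card_le_depth_add_one hε (⟨0, by omega⟩, true) t Finset.univ
    (fun s _ q q' => (hroute s s q q').2 rfl) (fun s _ s' _ => (hroute s s' _ _).1)
  simp only [Finset.card_univ, Fintype.card_prod, Fintype.card_fin, Fintype.card_bool] at hcard
  omega

end
end

section
/- For every integer k ≥ 3 and every function p : ℕ → ℕ, there exist sequences h_1,…,h_k and w_1,…,w_k of positive reals such that the weighted planar point-set X(w,h) satisfies: (i) some threshold decision tree over ℝ² with k leaves and depth k−1 induces on X(w,h) a clustering whose weighted k-means cost equals the minimum weighted k-means cost over all partitions of the 2k weighted points into at most k clusters; and (ii) every threshold decision tree over ℝ² with k leaves and depth at most k−2 induces on X(w,h) a clustering whose weighted k-means cost is at least p(2k) times that minimum. -/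
noncomputable section

attribute [local instance] Classical.propDecidable

/-! ### Closed form of the planar point-set -/

/-- The coordinate along which the cluster `C_{n+1}` extends. -/
def longDir (n : ℕ) : Fin 2 := if n % 2 = 0 then 0 else 1

/-- The common coordinate of both points of `C_{n+1}`. -/
def level (h : ℕ → ℝ) : ℕ → ℝ
  | 0 => 0
  | 1 => h 2
  | n + 2 => level h n + h (n + 3)

/-- The coordinate of `p_{n+1}^1` in direction `longDir n`. -/
def lowEnd : ℕ → ℝ
  | 0 => 0
  | 1 => 0
  | n + 2 => lowEnd n - 1

/-- The coordinate of `p_{n+1}^2` in direction `longDir n`. -/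
def highEnd (h : ℕ → ℝ) : ℕ → ℝ
  | 0 => 0
  | 1 => 0
  | n + 2 => level h (n + 1) + 1

/-- The point `p_{n+1}^{a+1}`. -/
def planarPt (h : ℕ → ℝ) (n : ℕ) (a : Fin 2) : EuclideanSpace ℝ (Fin 2) :=
  toE2 (if a = 0 then (planarP h (n + 1)).1 else (planarP h (n + 1)).2)

lemma wpt_eq (k : ℕ) (h : ℕ → ℝ) (x : Fin k × Fin 2) : wpt k h x = planarPt h x.1 x.2 := rfl

lemma planarP_succ (h : ℕ → ℝ) (n : ℕ) :
    planarP h (n + 1) = if n % 2 = 0 then ((lowEnd n, level h n), (highEnd h n, level h n))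
      else ((level h n, lowEnd n), (level h n, highEnd h n)) := by
  induction n using Nat.twoStepInduction with
  | zero => simp [planarP, lowEnd, level, highEnd]
  | one => simp [planarP, lowEnd, level, highEnd]
  | more n ih₀ ih₁ =>
    rcases Nat.mod_two_eq_zero_or_one n with hn | hn
    · have h₁ : (n + 1) % 2 ≠ 0 := by omega
      have h₂ : (n + 2) % 2 = 0 := by omega
      have h₃ : (n + 3) % 2 = 1 := by omega
      rw [if_pos hn] at ih₀
      rw [if_neg h₁] at ih₁
      rw [if_pos h₂]
      simp [planarP, ih₀, ih₁, h₃, lowEnd, level, highEnd]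
    · have h₁ : (n + 1) % 2 = 0 := by omega
      have h₂ : (n + 2) % 2 ≠ 0 := by omega
      have h₃ : ¬ (n + 3) % 2 = 1 := by omega
      rw [if_neg (by omega)] at ih₀
      rw [if_pos h₁] at ih₁
      rw [if_neg h₂]
      simp only [planarP, ih₀, ih₁, if_neg h₃, lowEnd, level, highEnd]

lemma longDir_add_two (n : ℕ) : longDir (n + 2) = longDir n := by
  simp [longDir]

lemma eq_longDir (n : ℕ) (r : Fin 2) : r = longDir n ∨ r = longDir (n + 1) := by
  rcases Nat.mod_two_eq_zero_or_one n with hn | hn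
  · have h₁ : (n + 1) % 2 ≠ 0 := by omega
    fin_cases r <;> simp [longDir, hn, h₁]
  · have h₁ : (n + 1) % 2 = 0 := by omega
    fin_cases r <;> simp [longDir, hn, h₁]

lemma planarPt_longDir (h : ℕ → ℝ) (n : ℕ) (a : Fin 2) :
    planarPt h n a (longDir n) = if a = 0 then lowEnd n else highEnd h n := by
  rcases Nat.mod_two_eq_zero_or_one n with hn | hn <;> fin_cases a <;>
    simp [planarPt, planarP_succ, toE2, longDir, hn]

lemma planarPt_longDir_succ (h : ℕ → ℝ) (n : ℕ) (a : Fin 2) :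
    planarPt h n a (longDir (n + 1)) = level h n := by
  rcases Nat.mod_two_eq_zero_or_one n with hn | hn
  · have h₁ : (n + 1) % 2 ≠ 0 := by omega
    fin_cases a <;> simp [planarPt, planarP_succ, toE2, longDir, hn, h₁]
  · have h₁ : (n + 1) % 2 = 0 := by omega
    fin_cases a <;> simp [planarPt, planarP_succ, toE2, longDir, hn, h₁]

lemma level_nonneg {h : ℕ → ℝ} (hh : ∀ i, 0 ≤ h i) (n : ℕ) : 0 ≤ level h n := by
  induction n using Nat.twoStepInduction with
  | zero => simp [level]
  | one => exact hh 2
  | more n ih₀ _ => exact add_nonneg ih₀ (hh _)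

lemma lowEnd_nonpos (n : ℕ) : lowEnd n ≤ 0 := by
  induction n using Nat.twoStepInduction with
  | zero => simp [lowEnd]
  | one => simp [lowEnd]
  | more n ih₀ _ => simp only [lowEnd]; linarith

lemma neg_le_lowEnd (n : ℕ) : -(n : ℝ) ≤ lowEnd n := by
  induction n using Nat.twoStepInduction with
  | zero => simp [lowEnd]
  | one => simp [lowEnd]
  | more n ih₀ _ => simp only [lowEnd]; push_cast; linarith

lemma highEnd_nonneg {h : ℕ → ℝ} (hh : ∀ i, 0 ≤ h i) : ∀ n, 0 ≤ highEnd h n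
  | 0 => le_rfl
  | 1 => le_rfl
  | n + 2 => add_nonneg (level_nonneg hh (n + 1)) zero_le_one

lemma highEnd_le_add_two {h : ℕ → ℝ} (hh : ∀ i, 0 ≤ h i) :
    ∀ n, highEnd h n ≤ highEnd h (n + 2)
  | 0 => highEnd_nonneg hh 2
  | 1 => highEnd_nonneg hh 3
  | n + 2 => by
    have := hh (n + 4)
    simp only [highEnd, level]
    linarith

/-- In direction `longDir m`, the cluster `C_{m+1}` spans all clusters up to itself. -/
lemma planarPt_mem_Icc {h : ℕ → ℝ} (hh : ∀ i, 0 ≤ h i) (m : ℕ) :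
    ∀ i ≤ m, ∀ a, planarPt h i a (longDir m) ∈ Set.Icc (lowEnd m) (highEnd h m) := by
  have diag : ∀ m a, planarPt h m a (longDir m) ∈ Set.Icc (lowEnd m) (highEnd h m) := by
    intro m a
    have := (lowEnd_nonpos m).trans (highEnd_nonneg hh m)
    rw [planarPt_longDir]
    split_ifs <;> simp [this]
  induction m using Nat.twoStepInduction with
  | zero =>
    intro i hi a
    obtain rfl : i = 0 := by omega
    exact diag 0 a
  | one =>
    intro i hi a
    obtain rfl | rfl : i = 0 ∨ i = 1 := by omega
    · rw [planarPt_longDir_succ]; simp [level, lowEnd, highEnd]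
    · exact diag 1 a
  | more m ih₀ _ =>
    intro i hi a
    obtain hi | rfl | rfl : i ≤ m ∨ i = m + 1 ∨ i = m + 2 := by omega
    · have := ih₀ i hi a
      rw [longDir_add_two]
      refine ⟨?_, this.2.trans (highEnd_le_add_two hh m)⟩
      have := this.1
      simp only [lowEnd]
      linarith
    · rw [planarPt_longDir_succ]
      refine ⟨(lowEnd_nonpos _).trans (level_nonneg hh _), ?_⟩
      simp [highEnd]
    · exact diag _ a

lemma highEnd_le_level_succ (h : ℕ → ℝ) :
    ∀ n, highEnd h n ≤ level h (n + 1) - (h (n + 2) - 1)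
  | 0 => by simp [highEnd, level]
  | 1 => by simp [highEnd, level]
  | n + 2 => by simp only [highEnd, level]; linarith

/-- In direction `longDir n`, all earlier clusters lie well below `C_{n+2}`. -/
lemma planarPt_le_level_succ {h : ℕ → ℝ} (hh : ∀ i, 1 ≤ h i) {i n : ℕ} (hi : i ≤ n) (a : Fin 2) :
    planarPt h i a (longDir n) ≤ level h (n + 1) - (h (n + 2) - 1) :=
  (planarPt_mem_Icc (fun i => zero_le_one.trans (hh i)) n i hi a).2.trans
    (highEnd_le_level_succ h n)

lemma le_norm_planarPt_sub {h : ℕ → ℝ} (hh : ∀ i, 1 ≤ h i) {i j : ℕ} (hij : i < j) (a b : Fin 2) :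
    h (j + 1) - 1 ≤ ‖planarPt h i a - planarPt h j b‖ := by
  obtain ⟨n, rfl⟩ : ∃ n, j = n + 1 := ⟨j - 1, by omega⟩
  have h₁ := planarPt_le_level_succ hh (Nat.lt_succ_iff.1 hij) a
  have h₂ := planarPt_longDir_succ h (n + 1) b
  rw [longDir_add_two] at h₂
  have h₃ := PiLp.norm_apply_le (planarPt h i a - planarPt h (n + 1) b) (longDir n)
  rw [PiLp.sub_apply, h₂, Real.norm_eq_abs] at h₃
  have h₄ := neg_le_abs (planarPt h i a (longDir n) - level h (n + 1))
  linarith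

/-! ### Trees -/

namespace TDT

lemma leaves_pos {d : ℕ} : ∀ t : TDT d, 0 < t.leaves
  | leaf => Nat.one_pos
  | node _ _ l r => Nat.add_pos_left l.leaves_pos r.leaves

lemma route_lt_leaves_s8 {d : ℕ} (t : TDT d) (x : EuclideanSpace ℝ (Fin d)) :
    t.route x < t.leaves := by
  induction t with
  | leaf => simp [route, leaves]
  | node r θ l rt ihl ihr =>
    simp only [route, leaves]
    split_ifs <;> omega

/-- The caterpillar tree cutting off `C_{n+1}, C_n, …, C_2` one after the other. -/
def caterpillar (h : ℕ → ℝ) : ℕ → TDT 2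
  | 0 => leaf
  | n + 1 => node (longDir n) (level h (n + 1)) (caterpillar h n) leaf

lemma leaves_caterpillar (h : ℕ → ℝ) (n : ℕ) : (caterpillar h n).leaves = n + 1 := by
  induction n with
  | zero => rfl
  | succ n ih => simp [caterpillar, leaves, ih]

lemma depth_caterpillar (h : ℕ → ℝ) (n : ℕ) : (caterpillar h n).depth = n := by
  induction n with
  | zero => rfl
  | succ n ih => simp [caterpillar, depth, ih]

lemma route_caterpillar {h : ℕ → ℝ} (hh : ∀ i, 1 ≤ h i) (hh' : ∀ i, 1 < h (i + 1)) (n : ℕ) :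
    ∀ i ≤ n, ∀ a, (caterpillar h n).route (planarPt h i a) = i := by
  induction n with
  | zero => intro i hi a; simp [caterpillar, route]; omega
  | succ n ih =>
    intro i hi a
    obtain hi | rfl : i ≤ n ∨ i = n + 1 := by omega
    · have h₁ := planarPt_le_level_succ hh hi a
      have h₂ := hh' (n + 1)
      rw [caterpillar, route, if_pos (by linarith), ih i hi a]
    · have h₂ := planarPt_longDir_succ h (n + 1) a
      rw [longDir_add_two] at h₂
      rw [caterpillar, route, if_neg (by rw [h₂]; exact lt_irrefl _), leaves_caterpillar]
      rfl

/-- A tree that separates the first `m + 1` clusters without splitting any of them has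
depth at least `m`. -/
lemma le_depth {h : ℕ → ℝ} (hh : ∀ i, 0 ≤ h i) (t : TDT 2) :
    ∀ m : ℕ, (∀ i ≤ m, ∀ j ≤ m, ∀ a b,
      (t.route (planarPt h i a) = t.route (planarPt h j b) ↔ i = j)) → m ≤ t.depth := by
  induction t with
  | leaf =>
    intro m hm
    have := (hm 0 (Nat.zero_le _) m le_rfl 0 0).1 rfl
    omega
  | node r θ l rt ihl ihr =>
    intro m hm
    rcases m with _ | m
    · exact Nat.zero_le _
    have side : ∀ i ≤ m + 1, (planarPt h i 0 r < θ ↔ planarPt h i 1 r < θ) := by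
      intro i hi
      have h₁ := (hm i hi i hi 0 1).2 rfl
      have h₂ := l.route_lt_leaves_s8 (planarPt h i 0)
      have h₃ := l.route_lt_leaves_s8 (planarPt h i 1)
      simp only [route] at h₁
      by_cases c₀ : planarPt h i 0 r < θ <;> by_cases c₁ : planarPt h i 1 r < θ <;>
        simp only [c₀, c₁, if_true, if_false] at h₁ ⊢ <;> omega
    obtain ⟨n, hmn, hn, rfl⟩ : ∃ n, m ≤ n ∧ n ≤ m + 1 ∧ r = longDir n := by
      rcases eq_longDir m r with hr | hr
      · exact ⟨m, le_rfl, by omega, hr⟩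
      · exact ⟨m + 1, by omega, le_rfl, hr⟩
    have hlo := planarPt_longDir h n 0
    have hhi := planarPt_longDir h n 1
    rw [if_pos rfl] at hlo
    rw [if_neg (by decide)] at hhi
    have hs := side n hn
    rw [hlo, hhi] at hs
    have key : m ≤ l.depth ∨ m ≤ rt.depth := by
      by_cases hc : highEnd h n < θ
      · refine Or.inl (ihl m fun i hi j hj a b => ?_)
        have c₁ := (planarPt_mem_Icc hh n i (hi.trans hmn) a).2.trans_lt hc
        have c₂ := (planarPt_mem_Icc hh n j (hj.trans hmn) b).2.trans_lt hc
        have := hm i (by omega) j (by omega) a b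
        rwa [route, route, if_pos c₁, if_pos c₂] at this
      · refine Or.inr (ihr m fun i hi j hj a b => ?_)
        have hc' : θ ≤ lowEnd n := not_lt.1 fun c => hc (hs.1 c)
        have c₁ := (hc'.trans (planarPt_mem_Icc hh n i (hi.trans hmn) a).1).not_gt
        have c₂ := (hc'.trans (planarPt_mem_Icc hh n j (hj.trans hmn) b).1).not_gt
        have := hm i (by omega) j (by omega) a b
        rwa [route, route, if_neg c₁, if_neg c₂, Nat.add_left_cancel_iff] at this
    simp only [depth]
    omega

end TDT

/-! ### Partitions -/

lemma eq_wCanonical {k : ℕ} {P : Finset (Finset (Fin k × Fin 2))} (hP : IsIdxPartition k P)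
    (hmono : ∀ S ∈ P, ∀ x ∈ S, ∀ y ∈ S, x.1 = y.1) : P = wCanonical k := by
  obtain ⟨hcard, -, hex⟩ := hP
  choose B hB huniq using hex
  have hinj : Set.InjOn (fun i : Fin k => B (i, 0)) (Finset.univ : Finset (Fin k)) := by
    intro i _ j _ hij
    have hij : B (i, 0) = B (j, 0) := hij
    exact hmono _ (hB (i, 0)).1 _ (hB (i, 0)).2 (j, 0) (hij ▸ (hB (j, 0)).2)
  have himg : Finset.univ.image (fun i : Fin k => B (i, 0)) = P := by
    refine Finset.eq_of_subset_of_card_le ?_ ?_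
    · intro S hS
      obtain ⟨i, -, rfl⟩ := Finset.mem_image.1 hS
      exact (hB (i, 0)).1
    · rw [Finset.card_image_of_injOn hinj]
      simpa using hcard
  rw [wCanonical, ← himg]
  refine Finset.image_congr fun i _ => ?_
  ext x
  simp only [Finset.mem_filter, Finset.mem_univ, true_and]
  refine ⟨fun hx => hmono _ (hB (i, 0)).1 _ hx _ (hB (i, 0)).2, ?_⟩
  rintro rfl
  have hmem := (hB x).1
  rw [← himg] at hmem
  obtain ⟨j, -, hj⟩ := Finset.mem_image.1 hmem
  have hj : B (j, 0) = B x := hj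
  have := hmono _ (hB x).1 _ (hB x).2 (j, 0) (hj ▸ (hB (j, 0)).2)
  change x ∈ B (x.1, 0)
  rw [this, hj]
  exact (hB x).2

lemma isIdxPartition_tree {k : ℕ} (h : ℕ → ℝ) {t : TDT 2} (ht : t.leaves ≤ k) :
    IsIdxPartition k (treeIdxPartition k t h) := by
  refine ⟨?_, fun S hS => (Finset.mem_filter.1 hS).2, fun x => ?_⟩
  · refine (Finset.card_filter_le _ _).trans (Finset.card_image_le.trans ?_)
    simpa using ht
  · refine ⟨Finset.univ.filter fun y => t.route (wpt k h y) = t.route (wpt k h x), ?_, ?_⟩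
    · refine ⟨Finset.mem_filter.2 ⟨Finset.mem_image.2 ⟨_, ?_, rfl⟩, x, by simp⟩, by simp⟩
      exact Finset.mem_range.2 (t.route_lt_leaves_s8 _)
    · rintro S ⟨hS, hx⟩
      obtain ⟨l, -, rfl⟩ := Finset.mem_image.1 (Finset.mem_filter.1 hS).1
      rw [(Finset.mem_filter.1 hx).2]

lemma route_eq_iff_of_tree_eq_wCanonical {k : ℕ} {h : ℕ → ℝ} {t : TDT 2}
    (ht : treeIdxPartition k t h = wCanonical k) (x y : Fin k × Fin 2) :
    t.route (wpt k h x) = t.route (wpt k h y) ↔ x.1 = y.1 := by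
  have hmem : (Finset.univ.filter fun z => t.route (wpt k h z) = t.route (wpt k h y)) ∈
      wCanonical k := by
    rw [← ht]
    refine Finset.mem_filter.2 ⟨Finset.mem_image.2 ⟨_, ?_, rfl⟩, y, by simp⟩
    exact Finset.mem_range.2 (t.route_lt_leaves_s8 _)
  obtain ⟨i, -, hi⟩ := Finset.mem_image.1 hmem
  have hx := Finset.ext_iff.1 hi x
  have hy := Finset.ext_iff.1 hi y
  simp only [Finset.mem_filter, Finset.mem_univ, true_and, iff_true] at hx hy
  rw [← hx, hy]

/-! ### Costs -/

lemma iInf_cost_nonneg {k : ℕ} (h : ℕ → ℝ) {w : ℕ → ℝ} (hw : ∀ i, 0 ≤ w i)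
    (S : Finset (Fin k × Fin 2)) :
    0 ≤ ⨅ c : EuclideanSpace ℝ (Fin 2), ∑ x ∈ S, w ((x.1 : ℕ) + 1) * ‖wpt k h x - c‖ ^ 2 :=
  Real.iInf_nonneg fun _ => Finset.sum_nonneg fun _ _ => mul_nonneg (hw _) (sq_nonneg _)

/-- A partition with a cluster meeting both `C_{i+1}` and `C_{j+1}`, `i < j`, costs at least
the price of putting a point of each into one cluster. -/
lemma le_wCostMeans {k : ℕ} {h w : ℕ → ℝ} (hh : ∀ i, 1 ≤ h i) (hw : ∀ i, 0 ≤ w i)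
    (hanti : Antitone w) {P : Finset (Finset (Fin k × Fin 2))} {S : Finset (Fin k × Fin 2)}
    (hS : S ∈ P) {x y : Fin k × Fin 2} (hx : x ∈ S) (hy : y ∈ S) (hxy : x.1 < y.1) :
    w (y.1 + 1) * (h (y.1 + 1) - 1) ^ 2 / 2 ≤ wCostMeans k h w P := by
  refine le_trans ?_ (Finset.single_le_sum (fun T _ => iInf_cost_nonneg h hw T) hS)
  refine le_ciInf fun c => ?_
  have hne : x ≠ y := fun e => hxy.ne (congrArg Prod.fst e)
  have hsub : ({x, y} : Finset (Fin k × Fin 2)) ⊆ S := by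
    intro z hz
    rcases Finset.mem_insert.1 hz with rfl | hz
    · exact hx
    · rwa [Finset.mem_singleton.1 hz]
  refine le_trans ?_ (Finset.sum_le_sum_of_subset_of_nonneg hsub
    fun z _ _ => mul_nonneg (hw _) (sq_nonneg _))
  rw [Finset.sum_pair hne]
  have hdist : h (y.1 + 1) - 1 ≤ ‖wpt k h x - c‖ + ‖wpt k h y - c‖ := by
    refine (le_norm_planarPt_sub hh hxy x.2 y.2).trans ?_
    rw [← wpt_eq, ← wpt_eq, ← sub_sub_sub_cancel_right _ _ c]
    exact norm_sub_le _ _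
  have hsq : (h (y.1 + 1) - 1) ^ 2 ≤ 2 * (‖wpt k h x - c‖ ^ 2 + ‖wpt k h y - c‖ ^ 2) := by
    have := pow_le_pow_left₀ (sub_nonneg.2 (hh _)) hdist 2
    linarith [sq_nonneg (‖wpt k h x - c‖ - ‖wpt k h y - c‖)]
  have hle : w (y.1 + 1) ≤ w (x.1 + 1) := hanti (Nat.succ_le_succ hxy.le)
  have h₁ := mul_le_mul_of_nonneg_left hsq (hw (y.1 + 1))
  have h₂ := mul_le_mul_of_nonneg_right hle (sq_nonneg ‖wpt k h x - c‖)
  linarith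

lemma norm_planarPt_one_sub_zero {h : ℕ → ℝ} (n : ℕ) :
    ‖planarPt h n 1 - planarPt h n 0‖ = |highEnd h n - lowEnd n| := by
  have h₁ := planarPt_longDir h n
  have h₂ := planarPt_longDir_succ h n
  rcases Nat.mod_two_eq_zero_or_one n with hn | hn
  · have hn' : (n + 1) % 2 ≠ 0 := by omega
    simp only [longDir, hn, hn', if_true, if_false] at h₁ h₂
    simp [EuclideanSpace.norm_eq, h₁, h₂, Real.sqrt_sq_eq_abs]
  · have hn' : (n + 1) % 2 = 0 := by omega
    simp only [longDir, hn, hn', if_true, one_ne_zero, if_false] at h₁ h₂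
    simp [EuclideanSpace.norm_eq, h₁, h₂, Real.sqrt_sq_eq_abs]

lemma wCostMeans_wCanonical_le (k : ℕ) (h : ℕ → ℝ) {w : ℕ → ℝ} (hw : ∀ i, 0 ≤ w i) :
    wCostMeans k h w (wCanonical k) ≤
      ∑ i : Fin k, w (i + 1) * (highEnd h i - lowEnd i) ^ 2 := by
  rw [wCostMeans, wCanonical, Finset.sum_image]
  · refine Finset.sum_le_sum fun i _ => ?_
    refine (ciInf_le ⟨0, ?_⟩ (wpt k h (i, 0))).trans ?_
    · rintro _ ⟨c, rfl⟩
      exact Finset.sum_nonneg fun _ _ => mul_nonneg (hw _) (sq_nonneg _)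
    · have : (Finset.univ.filter fun x : Fin k × Fin 2 => x.1 = i) = {(i, 0), (i, 1)} := by
        ext ⟨j, a⟩
        fin_cases a <;> simp
      rw [this, Finset.sum_pair (by simp)]
      simp [wpt_eq, norm_planarPt_one_sub_zero]
  · intro i _ j _ hij
    have := Finset.ext_iff.1 hij (i, 0)
    simpa using this

lemma level_pow_le {M : ℝ} (hM : 2 ≤ M) (n : ℕ) : level (fun i => M ^ i) n ≤ 2 * M ^ (n + 1) := by
  induction n using Nat.twoStepInduction with
  | zero => simp only [level]; positivity
  | one =>
    simp only [level]
    norm_num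
    linarith [sq_nonneg M]
  | more n ih₀ _ =>
    simp only [level]
    have : 0 < M ^ (n + 1) := by positivity
    have h₁ : M ^ (n + 3) = M ^ (n + 1) * M ^ 2 := by ring
    rw [h₁]
    nlinarith [mul_nonneg this.le (sub_nonneg.2 (pow_le_pow_left₀ zero_le_two hM 2))]

lemma highEnd_sub_lowEnd_pow_le {M : ℝ} (hM : 2 ≤ M) (n : ℕ) :
    highEnd (fun i => M ^ i) n - lowEnd n ≤ (n + 3) * M ^ n := by
  have h₁ := neg_le_lowEnd n
  have h₂ : 1 ≤ M ^ n := one_le_pow₀ (by linarith)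
  have h₃ : highEnd (fun i => M ^ i) n ≤ 2 * M ^ n + 1 := by
    rcases n with _ | _ | n
    · simp [highEnd]; norm_num
    · simp only [highEnd]; linarith
    · simp only [highEnd]
      linarith [level_pow_le hM (n + 1)]
  nlinarith [Nat.cast_nonneg (α := ℝ) n]

/-- STATEMENT: impossibility of shallow explanations in the plane for the weighted
point-set `X(w, h)` and the weighted k-means objective. -/
theorem stmt_8 (k : ℕ) (hk : 3 ≤ k) (p : ℕ → ℕ) :
    ∃ h w : ℕ → ℝ,
      (∀ i, 1 ≤ i → i ≤ k → 0 < h i) ∧ (∀ i, 1 ≤ i → i ≤ k → 0 < w i) ∧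
      (∃ t : TDT 2, t.leaves = k ∧ t.depth = k - 1 ∧
        wCostMeans k h w (treeIdxPartition k t h) = wOptMeans k h w) ∧
      ∀ t : TDT 2, t.leaves = k → t.depth ≤ k - 2 →
        (p (2 * k) : ℝ) * wOptMeans k h w ≤ wCostMeans k h w (treeIdxPartition k t h) := by
  obtain ⟨M, hMdef⟩ : ∃ M : ℝ, M = 8 * ((p (2 * k) : ℝ) + 1) * (k * (k + 3) ^ 2) := ⟨_, rfl⟩
  have hk' : (3 : ℝ) ≤ k := by exact_mod_cast hk
  have hp : (0 : ℝ) ≤ p (2 * k) := Nat.cast_nonneg _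
  have hM : 2 ≤ M := by
    have : (1 : ℝ) ≤ k * (k + 3) ^ 2 := by nlinarith
    rw [hMdef]
    nlinarith
  have hM0 : 0 < M := by linarith
  set h : ℕ → ℝ := fun i => M ^ i with hh
  set w : ℕ → ℝ := fun i => ((M ^ i) ^ 2)⁻¹ with hw
  have h_one : ∀ i, 1 ≤ h i := fun i => one_le_pow₀ (by linarith)
  have w_pos : ∀ i, 0 < w i := fun i => by positivity
  have w_anti : Antitone w := fun i j hij =>
    inv_anti₀ (by positivity)
      (pow_le_pow_left₀ (by positivity) (pow_le_pow_right₀ (by linarith) hij) 2)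
  have hcan : (p (2 * k) + 1) * wCostMeans k h w (wCanonical k) ≤ 1 / 8 := by
    have hbound : wCostMeans k h w (wCanonical k) ≤ k * (k + 3) ^ 2 / M ^ 2 := by
      refine (wCostMeans_wCanonical_le k h fun i => (w_pos i).le).trans ?_
      refine (Finset.sum_le_card_nsmul _ _ ((k + 3) ^ 2 / M ^ 2) fun i _ => ?_).trans ?_
      · have hik : ((i : ℕ) : ℝ) ≤ k := by exact_mod_cast i.2.le
        have hpow : 0 < M ^ (i : ℕ) := by positivity
        have h₁ : highEnd h i - lowEnd i ≤ (k + 3) * M ^ (i : ℕ) :=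
          (highEnd_sub_lowEnd_pow_le hM i).trans (by gcongr)
        have h₂ : 0 ≤ highEnd h i - lowEnd i :=
          sub_nonneg.2 ((lowEnd_nonpos i).trans
            (highEnd_nonneg (fun j => zero_le_one.trans (h_one j)) i))
        calc w (i + 1) * (highEnd h i - lowEnd i) ^ 2
            ≤ w (i + 1) * ((k + 3) * M ^ (i : ℕ)) ^ 2 :=
              mul_le_mul_of_nonneg_left (pow_le_pow_left₀ h₂ h₁ 2) (w_pos _).le
          _ = (k + 3) ^ 2 / M ^ 2 := by
              simp only [hw, pow_succ]
              field_simp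
      · simp [mul_div_assoc]
    calc (p (2 * k) + 1) * wCostMeans k h w (wCanonical k)
        ≤ (p (2 * k) + 1) * (k * (k + 3) ^ 2 / M ^ 2) :=
          mul_le_mul_of_nonneg_left hbound (by linarith)
      _ = M / M ^ 2 / 8 := by
          nth_rewrite 2 [hMdef]
          ring
      _ ≤ 1 / 8 := by
          gcongr
          rw [div_le_one (by positivity)]
          nlinarith
  have hcan0 : 0 ≤ wCostMeans k h w (wCanonical k) :=
    Finset.sum_nonneg fun S _ => iInf_cost_nonneg h (fun i => (w_pos i).le) S
  have hfar : ∀ P, IsIdxPartition k P → P ≠ wCanonical k → 1 / 8 ≤ wCostMeans k h w P := by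
    intro P hP hne
    obtain ⟨S, hS, x, hx, y, hy, hxy⟩ : ∃ S ∈ P, ∃ x ∈ S, ∃ y ∈ S, x.1 < y.1 := by
      by_contra! hcon
      exact hne (eq_wCanonical hP fun S hS x hx y hy =>
        le_antisymm (hcon S hS y hy x hx) (hcon S hS x hx y hy))
    refine le_trans ?_ (le_wCostMeans h_one (fun i => (w_pos i).le) w_anti hS hx hy hxy)
    have h₁ : 2 ≤ M ^ ((y.1 : ℕ) + 1) := hM.trans (le_self_pow₀ (by linarith) (by omega))
    simp only [hw, hh]
    generalize M ^ ((y.1 : ℕ) + 1) = z at h₁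
    rw [inv_mul_eq_div, div_div, div_le_div_iff₀ (by norm_num) (by positivity)]
    nlinarith
  have hcat : treeIdxPartition k (TDT.caterpillar h (k - 1)) h = wCanonical k := by
    refine eq_wCanonical (isIdxPartition_tree h (by rw [TDT.leaves_caterpillar]; omega)) ?_
    intro S hS x hx y hy
    obtain ⟨l, -, rfl⟩ := Finset.mem_image.1 (Finset.mem_filter.1 hS).1
    have hroute : ∀ z : Fin k × Fin 2, (TDT.caterpillar h (k - 1)).route (wpt k h z) = z.1 :=
      fun z => TDT.route_caterpillar h_one
        (fun i => one_lt_pow₀ (by linarith) (by omega)) _ _ (by omega) _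
    have hx := (Finset.mem_filter.1 hx).2
    have hy := (Finset.mem_filter.1 hy).2
    rw [hroute] at hx hy
    exact Fin.ext (hx.trans hy.symm)
  have hopt : wOptMeans k h w = wCostMeans k h w (wCanonical k) := by
    refine IsLeast.csInf_eq ⟨⟨_, ?_, rfl⟩, ?_⟩
    · rw [← hcat]
      exact isIdxPartition_tree h (by rw [TDT.leaves_caterpillar]; omega)
    · rintro _ ⟨P, hP, rfl⟩
      by_cases hne : P = wCanonical k
      · rw [hne]
      · have := hfar P hP hne
        nlinarith
  refine ⟨h, w, fun i _ _ => zero_lt_one.trans_le (h_one i), fun i _ _ => w_pos i,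
    ⟨TDT.caterpillar h (k - 1), ?_, TDT.depth_caterpillar h _, by rw [hcat, hopt]⟩, ?_⟩
  · rw [TDT.leaves_caterpillar]
    omega
  · intro t hleaves hdepth
    have hne : treeIdxPartition k t h ≠ wCanonical k := by
      intro heq
      have := TDT.le_depth (fun i => zero_le_one.trans (h_one i)) t (k - 1) fun i hi j hj a b => by
        simpa [wpt_eq, Fin.ext_iff] using route_eq_iff_of_tree_eq_wCanonical heq
          (⟨i, by omega⟩, a) (⟨j, by omega⟩, b)
      omega
    have := hfar _ (isIdxPartition_tree h hleaves.le) hne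
    rw [hopt]
    linarith

end
end
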